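/- For the path $P_n$, the cost of drunkenness satisfies $F(P_n) = \mathrm{ct}(P_n)/\mathrm{dct}(P_n) = 2 + o(1)$ as $n \to \infty$; equivalently, $\mathrm{dct}(P_n) = (1+o(1)) n/4$ while $\mathrm{ct}(P_n) = \lfloor n/2 \rfloor$. -/

import Mathlib

open scoped Classical ENNReal

namespace CopsRobbers

variable {V : Type*} [Fintype V]

/-- A strategy for `k` cops on the graph `G`: an initial configuration, and a move function
producing the next configuration from the current one and the full history of robber
positions; every cop either stays or moves along an edge. -/
structure CopStrategy (G : SimpleGraph V) (k : ℕ) where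
  init : Fin k → V
  move : (Fin k → V) → List V → (Fin k → V)
  move_legal : ∀ x h i, move x h i = x i ∨ G.Adj (x i) (move x h i)

/-- A strategy for the (adversarial) robber: an initial vertex chosen after seeing the cops'
initial configuration, and a move function producing the next vertex from the current one and
the full history of cop configurations (including the cops' latest move). -/
structure RobberStrategy (G : SimpleGraph V) (k : ℕ) where
  init : (Fin k → V) → V
  move : V → List (Fin k → V) → V
  move_legal : ∀ y h, move y h = y ∨ G.Adj y (move y h)

variable {G : SimpleGraph V} {k : ℕ}

/-- The play generated by a cop strategy and a robber strategy: chronological histories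
`([X_0,…,X_t], [Y_0,…,Y_t])`. In each round the cops move first, then the robber. -/
def playHist (sc : CopStrategy G k) (sr : RobberStrategy G k) : ℕ → List (Fin k → V) × List V
  | 0 => ([sc.init], [sr.init sc.init])
  | t + 1 =>
    let h := playHist sc sr t
    let x := sc.move (h.1.getLastD sc.init) h.2
    let y := sr.move (h.2.getLastD (sr.init sc.init)) (h.1 ++ [x])
    (h.1 ++ [x], h.2 ++ [y])

/-- Cop configuration at time `t`. -/
def copAt (sc : CopStrategy G k) (sr : RobberStrategy G k) (t : ℕ) : Fin k → V :=
  ((playHist sc sr t).1).getLastD sc.init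

/-- Robber position at time `t`. -/
def robAt (sc : CopStrategy G k) (sr : RobberStrategy G k) (t : ℕ) : V :=
  ((playHist sc sr t).2).getLastD (sr.init sc.init)

/-- The robber is caught at round `t`: some cop shares his vertex either after the robber's
move, or in mid-round right after the cops' move. -/
def caught (sc : CopStrategy G k) (sr : RobberStrategy G k) (t : ℕ) : Prop :=
  (∃ i, copAt sc sr t i = robAt sc sr t) ∨
    (0 < t ∧ ∃ i, copAt sc sr t i = robAt sc sr (t - 1))

/-- Capture time of a play (`∞` if the robber is never caught). -/
noncomputable def captureTime (sc : CopStrategy G k) (sr : RobberStrategy G k) : ℝ≥0∞ :=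
  ⨅ (t : ℕ) (_ : caught sc sr t), (t : ℝ≥0∞)

/-- `ct G k`: capture time of `k` cops against an adversarial robber under optimal play. -/
noncomputable def ct (G : SimpleGraph V) (k : ℕ) : ℝ≥0∞ :=
  ⨅ sc : CopStrategy G k, ⨆ sr : RobberStrategy G k, captureTime sc sr

/-- One-step transition probability of the drunk robber's simple random walk. -/
noncomputable def stepP (G : SimpleGraph V) (u v : V) : ℝ≥0∞ :=
  if G.Adj u v then ((G.degree u : ℝ≥0∞))⁻¹ else 0

/-- Probability of a robber trajectory `y_0, …, y_t`: uniform initial vertex, then simple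
random walk steps. -/
noncomputable def trajProb (G : SimpleGraph V) {t : ℕ} (y : Fin (t + 1) → V) : ℝ≥0∞ :=
  (Fintype.card V : ℝ≥0∞)⁻¹ * ∏ i : Fin t, stepP G (y i.castSucc) (y i.succ)

/-- The cop configurations determined by a cop strategy against a given robber trajectory. -/
def copPosD (sc : CopStrategy G k) (y : ℕ → V) : ℕ → Fin k → V
  | 0 => sc.init
  | t + 1 => sc.move (copPosD sc y t) (List.ofFn fun i : Fin (t + 1) => y i)

/-- The robber trajectory `y` leads to capture at round `t`. -/
def caughtD (sc : CopStrategy G k) (y : ℕ → V) (t : ℕ) : Prop :=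
  (∃ i, copPosD sc y t i = y t) ∨ (0 < t ∧ ∃ i, copPosD sc y t i = y (t - 1))

/-- Extend a finite trajectory to an infinite one. -/
def extTraj {t : ℕ} (y : Fin (t + 1) → V) : ℕ → V :=
  fun s => y ⟨min s t, by omega⟩

/-- `survive sc t` : probability that the drunk robber is not yet caught by round `t`,
i.e. `ℙ(T > t)`. -/
noncomputable def survive (sc : CopStrategy G k) (t : ℕ) : ℝ≥0∞ :=
  ∑ y : Fin (t + 1) → V,
    if ∀ s ≤ t, ¬ caughtD sc (extTraj y) s then trajProb G y else 0

/-- `dct G k`: minimum over cop strategies of the expected capture time of the drunk robber,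
computed by the tail-sum formula `𝔼T = ∑_{t≥0} ℙ(T > t)`. -/
noncomputable def dct (G : SimpleGraph V) (k : ℕ) : ℝ≥0∞ :=
  ⨅ sc : CopStrategy G k, ∑' t : ℕ, survive sc t

/-- The cop number: the least number of cops capturing the adversarial robber. -/
noncomputable def copNumber (G : SimpleGraph V) : ℕ :=
  sInf {k | ct G k ≠ ⊤}


set_option linter.unusedSectionVars false

/-! ### Helper lemmas: drunk robber, one-step analysis -/

lemma copPosD_congr (sc : CopStrategy G k) {y z : ℕ → V} :
    ∀ s : ℕ, (∀ r < s, y r = z r) → copPosD sc y s = copPosD sc z s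
  | 0, _ => rfl
  | s + 1, h => by
    have h1 := copPosD_congr sc s (fun r hr => h r (by omega))
    have h2 : (List.ofFn fun i : Fin (s + 1) => y i) = List.ofFn fun i : Fin (s + 1) => z i := by
      congr 1
      funext i
      exact h i i.2
    simp only [copPosD, h1, h2]

lemma caughtD_congr (sc : CopStrategy G k) {y z : ℕ → V} (s : ℕ) (h : ∀ r ≤ s, y r = z r) :
    caughtD sc y s ↔ caughtD sc z s := by
  unfold caughtD
  rw [copPosD_congr sc s (fun r hr => h r hr.le), h s le_rfl, h (s - 1) (by omega)]

lemma extTraj_snoc_le {t : ℕ} (y : Fin (t + 1) → V) (v : V) (s : ℕ) (hs : s ≤ t) :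
    extTraj (Fin.snoc y v : Fin (t + 1 + 1) → V) s = extTraj y s := by
  unfold extTraj
  have e : (⟨min s (t + 1), by omega⟩ : Fin (t + 1 + 1))
      = Fin.castSucc (⟨min s t, by omega⟩ : Fin (t + 1)) := by
    ext
    simp
    omega
  rw [e, Fin.snoc_castSucc (α := fun _ => V)]

lemma extTraj_last {t : ℕ} (y : Fin (t + 1) → V) : extTraj y t = y (Fin.last t) := by
  unfold extTraj
  congr 1
  ext
  simp

lemma trajProb_snoc {t : ℕ} (y : Fin (t + 1) → V) (v : V) :
    trajProb G (Fin.snoc y v : Fin (t + 1 + 1) → V)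
      = trajProb G y * stepP G (y (Fin.last t)) v := by
  unfold trajProb
  rw [Fin.prod_univ_castSucc, ← mul_assoc]
  congr 1
  · congr 1
    refine Finset.prod_congr rfl fun i _ => ?_
    rw [Fin.snoc_castSucc (α := fun _ => V), ← Fin.castSucc_succ,
      Fin.snoc_castSucc (α := fun _ => V)]
  · rw [Fin.snoc_castSucc (α := fun _ => V), Fin.succ_last, Fin.snoc_last (α := fun _ => V)]

/-- Expectation of `ψ` (cop position, robber position) over trajectories not yet caught. -/
noncomputable def aliveSum (sc : CopStrategy G k) (ψ : (Fin k → V) → V → ℝ≥0∞) (t : ℕ) : ℝ≥0∞ :=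
  ∑ y : Fin (t + 1) → V,
    if ∀ s ≤ t, ¬ caughtD sc (extTraj y) s then
      trajProb G y * ψ (copPosD sc (extTraj y) t) (y (Fin.last t)) else 0

/-- One-step expectation when the cops have moved to `x` and the robber steps from `u`. -/
noncomputable def stepE (G : SimpleGraph V) (ψ : (Fin k → V) → V → ℝ≥0∞) (x : Fin k → V) (u : V) :
    ℝ≥0∞ :=
  ∑ v, stepP G u v * (if (∃ i, x i = v) ∨ (∃ i, x i = u) then 0 else ψ x v)

lemma caught_split {P : ℕ → Prop} {t : ℕ} :
    (∀ s ≤ t + 1, ¬ P s) ↔ (∀ s ≤ t, ¬ P s) ∧ ¬ P (t + 1) := by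
  constructor
  · intro h
    exact ⟨fun s hs => h s (by omega), h _ le_rfl⟩
  · rintro ⟨h1, h2⟩ s hs
    rcases Nat.lt_or_ge t s with h | h
    · have : s = t + 1 := by omega
      exact this ▸ h2
    · exact h1 s h

lemma copPosD_snoc (sc : CopStrategy G k) {t : ℕ} (y : Fin (t + 1) → V) (v : V) :
    copPosD sc (extTraj (Fin.snoc y v : Fin (t + 1 + 1) → V)) (t + 1)
      = sc.move (copPosD sc (extTraj y) t) (List.ofFn y) := by
  have h1 : copPosD sc (extTraj (Fin.snoc y v : Fin (t + 1 + 1) → V)) t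
      = copPosD sc (extTraj y) t :=
    copPosD_congr sc t fun r hr => extTraj_snoc_le y v r hr.le
  have h2 : (List.ofFn fun i : Fin (t + 1) =>
      extTraj (Fin.snoc y v : Fin (t + 1 + 1) → V) i) = List.ofFn y := by
    congr 1
    funext i
    rw [extTraj_snoc_le y v i (by omega)]
    unfold extTraj
    congr 1
    ext
    simp
    omega
  simp only [copPosD, h1, h2]

lemma aliveSum_succ (sc : CopStrategy G k) (ψ : (Fin k → V) → V → ℝ≥0∞) (t : ℕ) :
    aliveSum sc ψ (t + 1) = ∑ y : Fin (t + 1) → V,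
      if ∀ s ≤ t, ¬ caughtD sc (extTraj y) s then
        trajProb G y * stepE G ψ (sc.move (copPosD sc (extTraj y) t) (List.ofFn y))
          (y (Fin.last t)) else 0 := by
  unfold aliveSum
  rw [← (Fin.snocEquiv (fun _ : Fin (t + 1 + 1) => V)).sum_comp, Fintype.sum_prod_type_right]
  refine Finset.sum_congr rfl fun y _ => ?_
  have key : ∀ v : V, (∀ s ≤ t + 1, ¬ caughtD sc (extTraj (Fin.snoc y v : Fin (t + 1 + 1) → V)) s)
      ↔ (∀ s ≤ t, ¬ caughtD sc (extTraj y) s) ∧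
        ¬ ((∃ i, sc.move (copPosD sc (extTraj y) t) (List.ofFn y) i = v) ∨
          (∃ i, sc.move (copPosD sc (extTraj y) t) (List.ofFn y) i = y (Fin.last t))) := by
    intro v
    have hlast : extTraj (Fin.snoc y v : Fin (t + 1 + 1) → V) (t + 1) = v := by
      rw [extTraj_last, Fin.snoc_last (α := fun _ => V)]
    rw [caught_split]
    refine and_congr ?_ (not_congr ?_)
    · refine forall_congr' fun s => forall_congr' fun hs => not_congr ?_
      exact caughtD_congr sc s fun r hr => extTraj_snoc_le y v r (hr.trans hs)
    · unfold caughtD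
      rw [copPosD_snoc, hlast, Nat.add_sub_cancel, extTraj_snoc_le y v t le_rfl, extTraj_last]
      simp
  by_cases h : ∀ s ≤ t, ¬ caughtD sc (extTraj y) s
  · rw [if_pos h]
    unfold stepE
    rw [Finset.mul_sum]
    refine Finset.sum_congr rfl fun v _ => ?_
    change (if ∀ s ≤ t + 1, ¬ caughtD sc (extTraj (Fin.snoc y v : Fin (t + 1 + 1) → V)) s then
      trajProb G (Fin.snoc y v : Fin (t + 1 + 1) → V) *
        ψ (copPosD sc (extTraj (Fin.snoc y v : Fin (t + 1 + 1) → V)) (t + 1))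
          ((Fin.snoc y v : Fin (t + 1 + 1) → V) (Fin.last (t + 1))) else 0) = _
    rw [trajProb_snoc, copPosD_snoc, Fin.snoc_last (α := fun _ => V)]
    by_cases hc : (∃ i, sc.move (copPosD sc (extTraj y) t) (List.ofFn y) i = v) ∨
          (∃ i, sc.move (copPosD sc (extTraj y) t) (List.ofFn y) i = y (Fin.last t))
    · rw [if_pos hc, if_neg (fun h' => ((key v).1 h').2 hc)]
      simp
    · rw [if_neg hc, if_pos ((key v).2 ⟨h, hc⟩), mul_assoc]
  · rw [if_neg h]
    refine Finset.sum_eq_zero fun v _ => ?_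
    exact if_neg (fun h' => h ((key v).1 h').1)

lemma aliveSum_one (sc : CopStrategy G k) (t : ℕ) :
    aliveSum sc (fun _ _ => 1) t = survive sc t := by
  simp [aliveSum, survive]

lemma aliveSum_zero (sc : CopStrategy G k) (ψ : (Fin k → V) → V → ℝ≥0∞) :
    aliveSum sc ψ 0 = (Fintype.card V : ℝ≥0∞)⁻¹ *
      ∑ u, if ∃ i, sc.init i = u then 0 else ψ sc.init u := by
  unfold aliveSum
  rw [Finset.mul_sum]
  refine Fintype.sum_equiv (Equiv.funUnique (Fin 1) V) _ _ fun y => ?_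
  have e : (Equiv.funUnique (Fin 1) V) y = y 0 := rfl
  rw [e]
  have e2 : (∀ s ≤ 0, ¬ caughtD sc (extTraj y) s) ↔ ¬ ∃ i, sc.init i = y 0 := by
    simp [caughtD, copPosD, extTraj]
  by_cases h : ∃ i, sc.init i = y 0
  · rw [if_pos h, if_neg (fun h' => e2.1 h' h), mul_zero]
  · rw [if_neg h, if_pos (e2.2 h)]
    simp [trajProb, copPosD]

lemma tsum_survive_le (sc : CopStrategy G k) (ψ : (Fin k → V) → V → ℝ≥0∞)
    (hψ : ∀ x h u, (∀ d, h.getLastD d = u) → (∀ i, x i ≠ u) →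
      stepE G ψ (sc.move x h) u + 1 ≤ ψ x u) :
    ∑' t, survive sc t ≤ (Fintype.card V : ℝ≥0∞)⁻¹ *
      ∑ u, if ∃ i, sc.init i = u then 0 else ψ sc.init u := by
  have step : ∀ t, aliveSum sc ψ (t + 1) + survive sc t ≤ aliveSum sc ψ t := by
    intro t
    rw [aliveSum_succ]
    unfold survive aliveSum
    rw [← Finset.sum_add_distrib]
    refine Finset.sum_le_sum fun y _ => ?_
    by_cases h : ∀ s ≤ t, ¬ caughtD sc (extTraj y) s
    · rw [if_pos h, if_pos h, if_pos h]
      have h2 := hψ (copPosD sc (extTraj y) t) (List.ofFn y) (y (Fin.last t)) (by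
        intro d
        rw [List.ofFn_succ', List.concat_eq_append, List.getLastD_concat]) (by
        intro i hi
        exact h t le_rfl (Or.inl ⟨i, by rw [extTraj_last]; exact hi⟩))
      calc _ = trajProb G y * (stepE G ψ (sc.move (copPosD sc (extTraj y) t) (List.ofFn y))
          (y (Fin.last t)) + 1) := by rw [mul_add, mul_one]
        _ ≤ _ := by gcongr
    · rw [if_neg h, if_neg h, if_neg h, add_zero]
  rw [← aliveSum_zero]
  have part : ∀ N, aliveSum sc ψ N + ∑ t ∈ Finset.range N, survive sc t ≤ aliveSum sc ψ 0 := by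
    intro N
    induction N with
    | zero => simp
    | succ N ih =>
      rw [Finset.sum_range_succ, add_comm (∑ t ∈ Finset.range N, survive sc t), ← add_assoc]
      exact (add_le_add_left (step N) _).trans ih
  exact ENNReal.tsum_le_of_sum_range_le fun N => le_add_self.trans (part N)

lemma le_tsum_survive (sc : CopStrategy G k) (ψ : (Fin k → V) → V → ℝ≥0∞) (c C : ℝ≥0∞)
    (hc : c ≠ 0) (hC : C ≠ ⊤) (hb : ∀ x u, ψ x u ≤ C)
    (hψ : ∀ x x' u, (∀ i, x' i = x i ∨ G.Adj (x i) (x' i)) →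
      ψ x u ≤ stepE G ψ x' u + c) :
    (Fintype.card V : ℝ≥0∞)⁻¹ * (∑ u, if ∃ i, sc.init i = u then 0 else ψ sc.init u) ≤
      c * ∑' t, survive sc t := by
  have step : ∀ t, aliveSum sc ψ t ≤ aliveSum sc ψ (t + 1) + c * survive sc t := by
    intro t
    rw [aliveSum_succ]
    unfold survive aliveSum
    rw [Finset.mul_sum, ← Finset.sum_add_distrib]
    refine Finset.sum_le_sum fun y _ => ?_
    by_cases h : ∀ s ≤ t, ¬ caughtD sc (extTraj y) s
    · rw [if_pos h, if_pos h, if_pos h]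
      have h2 := hψ (copPosD sc (extTraj y) t) (sc.move (copPosD sc (extTraj y) t) (List.ofFn y))
        (y (Fin.last t)) (fun i => sc.move_legal _ _ i)
      calc _ ≤ trajProb G y * (stepE G ψ (sc.move (copPosD sc (extTraj y) t) (List.ofFn y))
          (y (Fin.last t)) + c) := by gcongr
        _ = _ := by rw [mul_add, mul_comm c]
    · rw [if_neg h, if_neg h, if_neg h, mul_zero, add_zero]
  rw [← aliveSum_zero]
  by_cases hT : ∑' t, survive sc t = ⊤
  · rw [hT, ENNReal.mul_top hc]
    exact le_top
  have part : ∀ N, aliveSum sc ψ 0 ≤ aliveSum sc ψ N + c * ∑ t ∈ Finset.range N, survive sc t := by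
    intro N
    induction N with
    | zero => simp
    | succ N ih =>
      rw [Finset.sum_range_succ, add_comm (∑ t ∈ Finset.range N, survive sc t), mul_add,
        ← add_assoc]
      exact ih.trans (add_le_add_left (step N) _)
  have bd : ∀ N, aliveSum sc ψ N ≤ C * survive sc N := by
    intro N
    unfold aliveSum survive
    rw [Finset.mul_sum]
    refine Finset.sum_le_sum fun y _ => ?_
    by_cases h : ∀ s ≤ N, ¬ caughtD sc (extTraj y) s
    · rw [if_pos h, if_pos h, mul_comm C]
      gcongr
      exact hb _ _
    · rw [if_neg h, if_neg h, mul_zero]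
  have all : ∀ N, aliveSum sc ψ 0 ≤ C * survive sc N + c * ∑' t, survive sc t := by
    intro N
    refine (part N).trans (add_le_add (bd N) ?_)
    gcongr
    exact ENNReal.sum_le_tsum _
  have l1 := ENNReal.Tendsto.const_mul (a := C)
    (ENNReal.tendsto_atTop_zero_of_tsum_ne_top hT) (Or.inr hC)
  have l2 := l1.add_const (c * ∑' t, survive sc t)
  rw [mul_zero, zero_add] at l2
  exact ge_of_tendsto' l2 all

/-! ### Path graph: the chasing strategy and the capture time -/

/-- One step along the path from `x` towards `u`. -/
def chase {n : ℕ} (x u : Fin n) : Fin n :=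
  if h : x.1 < u.1 then ⟨x.1 + 1, by omega⟩
  else if u.1 < x.1 then ⟨x.1 - 1, by omega⟩ else x

lemma chase_val {n : ℕ} (x u : Fin n) :
    (chase x u).1 = if x.1 < u.1 then x.1 + 1 else if u.1 < x.1 then x.1 - 1 else x.1 := by
  unfold chase
  split_ifs <;> rfl

/-- The cop starts at `n / 2` and always steps towards the robber. -/
def chaseStrategy (n : ℕ) (hn : 1 ≤ n) : CopStrategy (SimpleGraph.pathGraph n) 1 where
  init := fun _ => ⟨n / 2, by omega⟩
  move := fun x h i => chase (x i) (h.getLastD (x i))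
  move_legal := by
    intro x h i
    rw [SimpleGraph.pathGraph_adj, Fin.ext_iff, chase_val]
    split_ifs <;> omega

lemma playHist_snd_getLastD (sc : CopStrategy G k) (sr : RobberStrategy G k) (t : ℕ) (d : V) :
    ((playHist sc sr t).2).getLastD d = robAt sc sr t := by
  cases t with
  | zero => rfl
  | succ t => simp only [robAt, playHist, List.getLastD_concat]

lemma copAt_succ (sc : CopStrategy G k) (sr : RobberStrategy G k) (t : ℕ) :
    copAt sc sr (t + 1) = sc.move (copAt sc sr t) (playHist sc sr t).2 := by
  simp only [copAt, playHist, List.getLastD_concat]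

lemma robAt_succ (sc : CopStrategy G k) (sr : RobberStrategy G k) (t : ℕ) :
    robAt sc sr (t + 1) = robAt sc sr t ∨ G.Adj (robAt sc sr t) (robAt sc sr (t + 1)) := by
  have := sr.move_legal (robAt sc sr t) (playHist sc sr (t + 1)).1
  simpa only [robAt, playHist, List.getLastD_concat] using this

lemma copAt_legal (sc : CopStrategy G k) (sr : RobberStrategy G k) (t : ℕ) (i : Fin k) :
    copAt sc sr (t + 1) i = copAt sc sr t i ∨ G.Adj (copAt sc sr t i) (copAt sc sr (t + 1) i) := by
  rw [copAt_succ]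
  exact sc.move_legal _ _ _

lemma captureTime_chase_le (n : ℕ) (hn : 1 ≤ n) (sr : RobberStrategy (SimpleGraph.pathGraph n) 1) :
    captureTime (chaseStrategy n hn) sr ≤ ((n / 2 : ℕ) : ℝ≥0∞) := by
  set sc := chaseStrategy n hn with hsc
  have inv : ∀ t, (∃ s ≤ t, caught sc sr s) ∨
      ((copAt sc sr t 0).1 < (robAt sc sr t).1 ∧ (copAt sc sr t 0).1 = n / 2 + t) ∨
      ((robAt sc sr t).1 < (copAt sc sr t 0).1 ∧ (copAt sc sr t 0).1 + t = n / 2) := by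
    intro t
    induction t with
    | zero =>
      have h0 : (copAt sc sr 0 0).1 = n / 2 := rfl
      rcases lt_trichotomy (copAt sc sr 0 0).1 (robAt sc sr 0).1 with h | h | h
      · exact Or.inr (Or.inl ⟨h, by omega⟩)
      · exact Or.inl ⟨0, le_rfl, Or.inl ⟨0, Fin.ext h⟩⟩
      · exact Or.inr (Or.inr ⟨h, by omega⟩)
    | succ t ih =>
      by_cases hc : ∃ s ≤ t + 1, caught sc sr s
      · exact Or.inl hc
      right
      have hc' : ¬ ∃ s ≤ t, caught sc sr s := fun ⟨s, hs, h⟩ => hc ⟨s, by omega, h⟩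
      have hct : ¬ caught sc sr (t + 1) := fun h => hc ⟨t + 1, le_rfl, h⟩
      have n1 : (copAt sc sr (t + 1) 0).1 ≠ (robAt sc sr (t + 1)).1 :=
        fun h => hct (Or.inl ⟨0, Fin.ext h⟩)
      have n2 : (copAt sc sr (t + 1) 0).1 ≠ (robAt sc sr t).1 :=
        fun h => hct (Or.inr ⟨by omega, 0, Fin.ext h⟩)
      have hx : (copAt sc sr (t + 1) 0).1 = (chase (copAt sc sr t 0) (robAt sc sr t)).1 := by
        rw [copAt_succ]
        change (chase (copAt sc sr t 0) ((playHist sc sr t).2.getLastD _)).1 = _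
        rw [playHist_snd_getLastD]
      rw [chase_val] at hx
      have hy := robAt_succ sc sr t
      rw [SimpleGraph.pathGraph_adj, Fin.ext_iff] at hy
      rcases ih with h | h | h
      · exact absurd h hc'
      · rw [if_pos h.1] at hx
        left
        omega
      · rw [if_neg (by omega), if_pos h.1] at hx
        right
        omega
  rcases inv (n / 2) with ⟨s, hs, h⟩ | h | h
  · exact (iInf₂_le s h).trans (by exact_mod_cast hs)
  · have := (robAt sc sr (n / 2)).2
    omega
  · omega

/-- The robber goes to the farther end of the path and stays there. -/
def farRobber (n : ℕ) (hn : 1 ≤ n) : RobberStrategy (SimpleGraph.pathGraph n) 1 where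
  init := fun x => if n / 2 ≤ (x 0).1 then ⟨0, by omega⟩ else ⟨n - 1, by omega⟩
  move := fun y _ => y
  move_legal := fun _ _ => Or.inl rfl

lemma le_captureTime_far (n : ℕ) (hn : 1 ≤ n) (sc : CopStrategy (SimpleGraph.pathGraph n) 1) :
    ((n / 2 : ℕ) : ℝ≥0∞) ≤ captureTime sc (farRobber n hn) := by
  set sr := farRobber n hn with hsr
  have hr : ∀ t, robAt sc sr t = sr.init sc.init := by
    intro t
    induction t with
    | zero => rfl
    | succ t ih =>
      rw [← ih]
      simp only [robAt, playHist, List.getLastD_concat]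
      rfl
  have hc : ∀ t, (copAt sc sr t 0).1 ≤ (sc.init 0).1 + t ∧ (sc.init 0).1 ≤ (copAt sc sr t 0).1 + t := by
    intro t
    induction t with
    | zero => exact ⟨le_rfl, le_rfl⟩
    | succ t ih =>
      have := copAt_legal sc sr t 0
      rw [SimpleGraph.pathGraph_adj, Fin.ext_iff] at this
      omega
  refine le_iInf₂ fun t ht => ?_
  have h1 : (copAt sc sr t 0).1 = (sr.init sc.init).1 := by
    rcases ht with ⟨i, h⟩ | ⟨_, i, h⟩
    · rw [hr, Subsingleton.elim i 0] at h
      rw [h]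
    · rw [hr, Subsingleton.elim i 0] at h
      rw [h]
  have h2 : (sr.init sc.init).1 = if n / 2 ≤ (sc.init 0).1 then 0 else n - 1 := by
    change (if n / 2 ≤ (sc.init 0).1 then (⟨0, by omega⟩ : Fin n) else ⟨n - 1, by omega⟩).1 = _
    split_ifs <;> rfl
  have h3 := hc t
  have : n / 2 ≤ t := by
    split_ifs at h2 <;> omega
  exact_mod_cast this

lemma ct_pathGraph (n : ℕ) (hn : 1 ≤ n) :
    ct (SimpleGraph.pathGraph n) 1 = ((n / 2 : ℕ) : ℝ≥0∞) := by
  apply le_antisymm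
  · exact (iInf_le _ (chaseStrategy n hn)).trans (iSup_le fun sr => captureTime_chase_le n hn sr)
  · exact le_iInf fun sc => (le_captureTime_far n hn sc).trans (le_iSup (captureTime sc) _)

/-! ### Path graph: random-walk steps -/

lemma sum_stepP_of_nbrs (u : V) (S : Finset V) (hS : ∀ v, G.Adj u v ↔ v ∈ S)
    (f : V → ℝ≥0∞) : ∑ v, stepP G u v * f v = ∑ v ∈ S, (S.card : ℝ≥0∞)⁻¹ * f v := by
  have hd : G.degree u = S.card := by
    rw [← SimpleGraph.card_neighborFinset_eq_degree]
    congr 1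
    ext v
    rw [SimpleGraph.mem_neighborFinset, hS]
  rw [← Finset.sum_subset (Finset.subset_univ S)]
  · refine Finset.sum_congr rfl fun v hv => ?_
    rw [stepP, if_pos ((hS v).2 hv), hd]
  · intro v _ hv
    rw [stepP, if_neg (fun h => hv ((hS v).1 h)), zero_mul]

lemma pathStep (n : ℕ) (hn : 2 ≤ n) (u : Fin n) (g : ℝ → ℝ) (hg : ∀ z, 0 ≤ g z) :
    ∃ r, ∑ v : Fin n, stepP (SimpleGraph.pathGraph n) u v * ENNReal.ofReal (g (v : ℕ))
        = ENNReal.ofReal r ∧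
      ((((u : ℕ) : ℝ) = 0 ∧ r = g 1) ∨ (((u : ℕ) : ℝ) = n - 1 ∧ r = g (n - 2)) ∨
        (1 ≤ ((u : ℕ) : ℝ) ∧ ((u : ℕ) : ℝ) ≤ n - 2 ∧
          r = (g ((u : ℕ) - 1) + g ((u : ℕ) + 1)) / 2)) := by
  have hu := u.2
  by_cases h0 : u.1 = 0
  · refine ⟨g 1, ?_, Or.inl ⟨by simp [h0], rfl⟩⟩
    rw [sum_stepP_of_nbrs u {⟨1, by omega⟩}]
    · simp
    · intro v
      rw [SimpleGraph.pathGraph_adj, Finset.mem_singleton, Fin.ext_iff]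
      simp only
      omega
  by_cases h1 : u.1 = n - 1
  · refine ⟨g (n - 2), ?_, Or.inr (Or.inl ⟨?_, rfl⟩)⟩
    · rw [sum_stepP_of_nbrs u {⟨n - 2, by omega⟩}]
      · simp [Nat.cast_sub hn]
      · intro v
        rw [SimpleGraph.pathGraph_adj, Finset.mem_singleton, Fin.ext_iff]
        simp only
        omega
    · rw [h1, Nat.cast_sub (by omega)]
      simp
  · refine ⟨_, ?_, Or.inr (Or.inr ⟨?_, ?_, rfl⟩)⟩
    · rw [sum_stepP_of_nbrs u {⟨u.1 - 1, by omega⟩, ⟨u.1 + 1, by omega⟩}]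
      · have hne : (⟨u.1 - 1, by omega⟩ : Fin n) ≠ ⟨u.1 + 1, by omega⟩ := by
          rw [Ne, Fin.ext_iff]
          simp only
          omega
        rw [Finset.sum_pair hne, Finset.card_pair hne, ← mul_add,
          ← ENNReal.ofReal_add (hg _) (hg _)]
        simp only
        rw [Nat.cast_sub (by omega), div_eq_inv_mul, ENNReal.ofReal_mul (by norm_num),
          ENNReal.ofReal_inv_of_pos (by norm_num)]
        simp
      · intro v
        rw [SimpleGraph.pathGraph_adj, Finset.mem_insert, Finset.mem_singleton, Fin.ext_iff,
          Fin.ext_iff]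
        simp only
        omega
    · exact_mod_cast (by omega : 1 ≤ u.1)
    · have : u.1 + 2 ≤ n := by omega
      have : (u.1 : ℝ) + 2 ≤ n := by exact_mod_cast this
      linarith

lemma sum_range_sub (c : ℝ) (m : ℕ) :
    ∑ u ∈ Finset.range m, (c - (u : ℝ)) = m * c - m * (m - 1) / 2 := by
  induction m with
  | zero => simp
  | succ m ih =>
    rw [Finset.sum_range_succ, ih]
    push_cast
    ring

lemma sum_abs_range (x j : ℕ) :
    ∑ u ∈ Finset.range (x + j), |(x : ℝ) - u| = x * (x + 1) / 2 + j * (j - 1) / 2 := by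
  induction j with
  | zero =>
    have : ∑ u ∈ Finset.range (x + 0), |(x : ℝ) - u| = ∑ u ∈ Finset.range x, ((x : ℝ) - u) := by
      refine Finset.sum_congr rfl fun u hu => abs_of_nonneg ?_
      have : (u : ℝ) ≤ x := by exact_mod_cast (Finset.mem_range.1 hu).le
      linarith
    rw [this, sum_range_sub]
    push_cast
    ring
  | succ j ih =>
    rw [← add_assoc, Finset.sum_range_succ, ih]
    have : |(x : ℝ) - ((x + j : ℕ) : ℝ)| = j := by
      push_cast
      rw [abs_of_nonpos] <;> linarith [(Nat.cast_nonneg j : (0 : ℝ) ≤ j)]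
    rw [this]
    push_cast
    ring

lemma sum_abs_fin (n : ℕ) (x : Fin n) :
    ∑ u : Fin n, |((x : ℕ) : ℝ) - ((u : ℕ) : ℝ)|
      = (x : ℕ) * ((x : ℕ) + 1) / 2 + (n - (x : ℕ)) * (n - (x : ℕ) - 1) / 2 := by
  rw [Fin.sum_univ_eq_sum_range (fun u => |((x : ℕ) : ℝ) - (u : ℝ)|) n]
  have h : x.1 + (n - x.1) = n := by omega
  have h2 := sum_abs_range x.1 (n - x.1)
  rw [h, Nat.cast_sub x.2.le] at h2
  exact h2

/-! ### Upper bound for `dct` -/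

lemma dct_le (n : ℕ) (hn : 2 ≤ n) :
    dct (SimpleGraph.pathGraph n) 1 ≤ ENNReal.ofReal (n / 4) := by
  refine (iInf_le _ (chaseStrategy n (by omega))).trans ?_
  refine (tsum_survive_le _
    (fun (x : Fin 1 → Fin n) (u : Fin n) => ENNReal.ofReal |((x 0 : ℕ) : ℝ) - ((u : ℕ) : ℝ)|) ?_).trans ?_
  · intro x h u hh hx
    have hx0 : (x 0).1 ≠ u.1 := fun h' => hx 0 (Fin.ext h')
    set x' := (chaseStrategy n (by omega)).move x h with hx'
    have e : x' 0 = chase (x 0) u := by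
      change chase (x 0) (h.getLastD (x 0)) = _
      rw [hh]
    have e2 := congrArg Fin.val e
    rw [chase_val] at e2
    by_cases hc : (x' 0).1 = u.1
    · have : stepE (SimpleGraph.pathGraph n) (fun (x : Fin 1 → Fin n) (u : Fin n) =>
          ENNReal.ofReal |((x 0 : ℕ) : ℝ) - ((u : ℕ) : ℝ)|) x' u = 0 := by
        unfold stepE
        refine Finset.sum_eq_zero fun v _ => ?_
        rw [if_pos (Or.inr ⟨0, Fin.ext hc⟩), mul_zero]
      rw [this, zero_add, ← ENNReal.ofReal_one]
      apply ENNReal.ofReal_le_ofReal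
      rcases lt_or_gt_of_ne hx0 with h1 | h1
      · have : ((x 0).1 : ℝ) + 1 ≤ u.1 := by exact_mod_cast h1
        rw [abs_of_nonpos] <;> linarith
      · have : (u.1 : ℝ) + 1 ≤ (x 0).1 := by exact_mod_cast h1
        rw [abs_of_nonneg] <;> linarith
    · obtain ⟨r, hr, hcase⟩ := pathStep n hn u (fun z => |((x' 0 : ℕ) : ℝ) - z|)
        (fun z => abs_nonneg _)
      have hle : stepE (SimpleGraph.pathGraph n) (fun (x : Fin 1 → Fin n) (u : Fin n) =>
          ENNReal.ofReal |((x 0 : ℕ) : ℝ) - ((u : ℕ) : ℝ)|) x' u ≤ ENNReal.ofReal r := by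
        rw [← hr]
        unfold stepE
        refine Finset.sum_le_sum fun v _ => ?_
        gcongr
        split_ifs
        · exact zero_le
        · exact le_rfl
      have hr0 : 0 ≤ r := by
        rcases hcase with ⟨_, h⟩ | ⟨_, h⟩ | ⟨_, _, h⟩ <;> rw [h] <;> positivity
      refine (add_le_add_left hle 1).trans ?_
      rw [← ENNReal.ofReal_one, ← ENNReal.ofReal_add hr0 zero_le_one]
      apply ENNReal.ofReal_le_ofReal
      have hb1 : ((x' 0).1 : ℝ) ≤ n - 1 := by
        have : (x' 0).1 + 1 ≤ n := (x' 0).2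
        have : ((x' 0).1 : ℝ) + 1 ≤ n := by exact_mod_cast this
        linarith
      have hb0 : (0 : ℝ) ≤ (x' 0).1 := Nat.cast_nonneg _
      rcases lt_or_gt_of_ne hx0 with h1 | h1
      · rw [if_pos h1] at e2
        have h3 : (x' 0).1 + 1 ≤ u.1 := by omega
        have h3' : ((x' 0).1 : ℝ) + 1 ≤ u.1 := by exact_mod_cast h3
        have e2' : ((x' 0).1 : ℝ) = (x 0).1 + 1 := by exact_mod_cast e2
        rw [abs_of_nonpos (by linarith : ((x 0).1 : ℝ) - u.1 ≤ 0)]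
        rcases hcase with ⟨hu, h⟩ | ⟨hu, h⟩ | ⟨hu, hu', h⟩
        · linarith
        · rw [abs_of_nonpos (by linarith)] at h
          linarith
        · rw [abs_of_nonpos (by linarith), abs_of_nonpos (by linarith)] at h
          linarith
      · rw [if_neg (by omega), if_pos h1] at e2
        have h3 : u.1 + 1 ≤ (x' 0).1 := by omega
        have h3' : (u.1 : ℝ) + 1 ≤ (x' 0).1 := by exact_mod_cast h3
        have e3 : (x' 0).1 + 1 = (x 0).1 := by omega
        have e2' : ((x' 0).1 : ℝ) + 1 = (x 0).1 := by exact_mod_cast e3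
        rw [abs_of_nonneg (by linarith : 0 ≤ ((x 0).1 : ℝ) - u.1)]
        rcases hcase with ⟨hu, h⟩ | ⟨hu, h⟩ | ⟨hu, hu', h⟩
        · rw [abs_of_nonneg (by linarith)] at h
          linarith
        · linarith
        · rw [abs_of_nonneg (by linarith), abs_of_nonneg (by linarith)] at h
          linarith
  · have hn0 : (0 : ℝ) < n := by exact_mod_cast (by omega : 0 < n)
    have hle : (∑ u : Fin n, if ∃ i, (chaseStrategy n (by omega)).init i = u then 0 else
        ENNReal.ofReal |(((chaseStrategy n (by omega)).init 0 : ℕ) : ℝ) - ((u : ℕ) : ℝ)|)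
        ≤ ENNReal.ofReal (n * n / 4) := by
      calc _ ≤ ∑ u : Fin n, ENNReal.ofReal
            |(((chaseStrategy n (by omega)).init 0 : ℕ) : ℝ) - ((u : ℕ) : ℝ)| := by
            refine Finset.sum_le_sum fun u _ => ?_
            split_ifs
            · exact zero_le
            · exact le_rfl
        _ = ENNReal.ofReal (∑ u : Fin n,
            |(((chaseStrategy n (by omega)).init 0 : ℕ) : ℝ) - ((u : ℕ) : ℝ)|) :=
            (ENNReal.ofReal_sum_of_nonneg fun _ _ => abs_nonneg _).symm
        _ ≤ _ := by
            apply ENNReal.ofReal_le_ofReal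
            rw [sum_abs_fin]
            have e : (((chaseStrategy n (by omega)).init 0 : Fin n) : ℕ) = n / 2 := rfl
            rw [e]
            rcases Nat.even_or_odd' n with ⟨m, hm | hm⟩
            · have : n / 2 = m := by omega
              rw [this, hm]
              push_cast
              nlinarith
            · have : n / 2 = m := by omega
              rw [this, hm]
              push_cast
              nlinarith
    calc _ ≤ (Fintype.card (Fin n) : ℝ≥0∞)⁻¹ * ENNReal.ofReal (n * n / 4) := by
          gcongr
          refine le_trans (le_of_eq ?_) hle
          congr!
      _ = ENNReal.ofReal (n / 4) := by
          rw [Fintype.card_fin, ← ENNReal.ofReal_natCast, ← ENNReal.ofReal_inv_of_pos hn0,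
            ← ENNReal.ofReal_mul (by positivity)]
          congr 1
          field_simp

/-! ### Lower bound for `dct` -/

/-- Boundary correction: quadratic near the ends of the path, zero elsewhere. -/
noncomputable def qcor (n : ℕ) (L z : ℝ) : ℝ :=
  (max 0 (L - z) ^ 2 + max 0 (L - (n - 1 - z)) ^ 2) / (2 * L)

lemma sq_max_second_diff (z : ℝ) :
    max 0 (z + 1) ^ 2 + max 0 (z - 1) ^ 2 ≤ 2 * max 0 z ^ 2 + 2 := by
  rcases le_total 0 z with h | h
  · rw [max_eq_right h, max_eq_right (by linarith : 0 ≤ z + 1)]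
    rcases le_total 0 (z - 1) with h1 | h1
    · rw [max_eq_right h1]
      nlinarith
    · rw [max_eq_left h1]
      nlinarith
  · rw [max_eq_left h, max_eq_left (by linarith : z - 1 ≤ 0)]
    rcases le_total 0 (z + 1) with h1 | h1
    · rw [max_eq_right h1]
      nlinarith
    · rw [max_eq_left h1]
      nlinarith

lemma qcor_nonneg (n : ℕ) {L : ℝ} (hL : 1 ≤ L) (z : ℝ) : 0 ≤ qcor n L z := by
  unfold qcor
  positivity

lemma qcor_le (n : ℕ) {L : ℝ} (hL : 1 ≤ L) {z : ℝ} (h0 : 0 ≤ z) (h1 : z ≤ n - 1) :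
    qcor n L z ≤ L := by
  unfold qcor
  rw [div_le_iff₀ (by linarith)]
  have a1 : max 0 (L - z) ^ 2 ≤ L ^ 2 := by
    gcongr
    exact max_le (by linarith) (by linarith)
  have a2 : max 0 (L - (n - 1 - z)) ^ 2 ≤ L ^ 2 := by
    gcongr
    exact max_le (by linarith) (by linarith)
  nlinarith

lemma qcor_interior (n : ℕ) {L : ℝ} (hL : 1 ≤ L) (z : ℝ) :
    (qcor n L (z - 1) + qcor n L (z + 1)) / 2 ≤ qcor n L z + 1 / L := by
  have h1 := sq_max_second_diff (L - z)
  have h2 := sq_max_second_diff (L - (n - 1 - z))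
  have e1 : L - z + 1 = L - (z - 1) := by ring
  have e2 : L - z - 1 = L - (z + 1) := by ring
  have e3 : L - (n - 1 - z) + 1 = L - (n - 1 - (z + 1)) := by ring
  have e4 : L - (n - 1 - z) - 1 = L - (n - 1 - (z - 1)) := by ring
  rw [e1, e2] at h1
  rw [e3, e4] at h2
  unfold qcor
  have hL0 : 0 < L := by linarith
  generalize max 0 (L - z) ^ 2 = a0 at *
  generalize max 0 (L - (z - 1)) ^ 2 = a1 at *
  generalize max 0 (L - (z + 1)) ^ 2 = a2 at *
  generalize max 0 (L - (n - 1 - z)) ^ 2 = b0 at *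
  generalize max 0 (L - (n - 1 - (z - 1))) ^ 2 = b1 at *
  generalize max 0 (L - (n - 1 - (z + 1))) ^ 2 = b2 at *
  have e : ((a0 + b0) / (2 * L) + 1 / L) - ((a1 + b1) / (2 * L) + (a2 + b2) / (2 * L)) / 2
      = ((2 * a0 + 2 - (a1 + a2)) + (2 * b0 + 2 - (b2 + b1))) / (4 * L) := by
    field_simp
    ring
  have : 0 ≤ ((2 * a0 + 2 - (a1 + a2)) + (2 * b0 + 2 - (b2 + b1))) / (4 * L) :=
    div_nonneg (by linarith) (by linarith)
  linarith

lemma qcor_left (n : ℕ) {L : ℝ} (hL : 1 ≤ L) (hn : L ≤ n - 2) :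
    qcor n L 1 + 1 ≤ qcor n L 0 + 1 / L := by
  unfold qcor
  have hL0 : 0 < L := by linarith
  rw [max_eq_right (by linarith : 0 ≤ L - 1), max_eq_right (by linarith : 0 ≤ L - 0),
    max_eq_left (by linarith : L - ((n : ℝ) - 1 - 1) ≤ 0),
    max_eq_left (by linarith : L - ((n : ℝ) - 1 - 0) ≤ 0)]
  field_simp
  nlinarith

lemma qcor_right (n : ℕ) {L : ℝ} (hL : 1 ≤ L) (hn : L ≤ n - 2) :
    qcor n L (n - 2) + 1 ≤ qcor n L (n - 1) + 1 / L := by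
  have h := qcor_left n hL hn
  have e1 : qcor n L (n - 2) = qcor n L 1 := by
    unfold qcor
    rw [add_comm]
    congr 4 <;> ring_nf
  have e2 : qcor n L (n - 1) = qcor n L 0 := by
    unfold qcor
    rw [add_comm]
    congr 4 <;> ring_nf
  rw [e1, e2]
  exact h

/-- Real potential for the lower bound. -/
noncomputable def pot (n : ℕ) (L x z : ℝ) : ℝ := max 0 (|x - z| - qcor n L z - 1)

lemma pot_step (n : ℕ) {L x x' u r : ℝ} (hL : 1 ≤ L) (hn : L ≤ n - 2) (hx : |x - x'| ≤ 1)
    (h : (u = 0 ∧ r = pot n L x' 1) ∨ (u = n - 1 ∧ r = pot n L x' (n - 2)) ∨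
        (1 ≤ u ∧ u ≤ n - 2 ∧ r = (pot n L x' (u - 1) + pot n L x' (u + 1)) / 2)) :
    0 ≤ r ∧ pot n L x u ≤ r + (1 + 1 / L) := by
  have hp : ∀ z, 0 ≤ pot n L x' z := fun z => le_max_left _ _
  have hp' : ∀ z, |x' - z| - qcor n L z - 1 ≤ pot n L x' z := fun z => le_max_right _ _
  have hL' : 0 < 1 / L := by positivity
  have hr : 0 ≤ r := by
    rcases h with ⟨_, h⟩ | ⟨_, h⟩ | ⟨_, _, h⟩
    · exact h ▸ hp _
    · exact h ▸ hp _
    · have := hp (u - 1)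
      have := hp (u + 1)
      linarith
  refine ⟨hr, max_le (by linarith) ?_⟩
  have t1 : |x - u| ≤ |x - x'| + |x' - u| := abs_sub_le _ _ _
  rcases h with ⟨hu, h⟩ | ⟨hu, h⟩ | ⟨_, _, h⟩
  · have := hp' 1
    have := qcor_left n hL hn
    have t2 : |x' - 0| ≤ |x' - 1| + |(1 : ℝ) - 0| := abs_sub_le _ _ _
    rw [hu] at t1 ⊢
    norm_num at t2
    simp only [sub_zero] at t1 ⊢
    linarith
  · have := hp' (n - 2)
    have := qcor_right n hL hn
    have t2 : |x' - (n - 1)| ≤ |x' - (n - 2)| + |((n : ℝ) - 2) - (n - 1)| := abs_sub_le _ _ _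
    have t3 : |((n : ℝ) - 2) - (n - 1)| = 1 := by
      rw [show ((n : ℝ) - 2) - (n - 1) = -1 by ring]
      norm_num
    rw [hu] at t1 ⊢
    linarith
  · have := hp' (u - 1)
    have := hp' (u + 1)
    have := qcor_interior n hL u
    have t2 : |(x' - (u - 1)) + (x' - (u + 1))| ≤ |x' - (u - 1)| + |x' - (u + 1)| :=
      abs_add_le _ _
    rw [show (x' - (u - 1)) + (x' - (u + 1)) = 2 * (x' - u) by ring, abs_mul, abs_two] at t2
    linarith

lemma le_dct (n : ℕ) (hn2 : 2 ≤ n) {L : ℝ} (hL : 1 ≤ L) (hn : L ≤ n - 2) :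
    ENNReal.ofReal ((n - 1 / n) / 4 - L - 1) / ENNReal.ofReal (1 + 1 / L)
      ≤ dct (SimpleGraph.pathGraph n) 1 := by
  refine le_iInf fun sc => ?_
  have hn0 : (0 : ℝ) < n := by exact_mod_cast (by omega : 0 < n)
  have hfin : ∀ u : Fin n, (0 : ℝ) ≤ u.1 ∧ (u.1 : ℝ) ≤ n - 1 := by
    intro u
    have : u.1 + 1 ≤ n := u.2
    have : (u.1 : ℝ) + 1 ≤ n := by exact_mod_cast this
    exact ⟨Nat.cast_nonneg _, by linarith⟩
  have hadj : ∀ u v : Fin n, (v = u ∨ (SimpleGraph.pathGraph n).Adj u v) →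
      |(u.1 : ℝ) - v.1| ≤ 1 := by
    intro u v h
    rw [SimpleGraph.pathGraph_adj, Fin.ext_iff] at h
    rcases h with h | h | h
    · rw [h]
      simp
    · rw [← h]
      push_cast
      rw [abs_le]
      constructor <;> linarith
    · rw [← h]
      push_cast
      rw [abs_le]
      constructor <;> linarith
  have pot0 : ∀ u v : Fin n, |(u.1 : ℝ) - v.1| ≤ 1 → pot n L u.1 v.1 = 0 := by
    intro u v h
    have := qcor_nonneg n hL (v.1 : ℝ)
    exact max_eq_left (by linarith)
  have hc0 : 0 < 1 + 1 / L := by positivity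
  have main := le_tsum_survive sc
    (fun (x : Fin 1 → Fin n) (u : Fin n) => ENNReal.ofReal (pot n L (x 0).1 u.1))
    (ENNReal.ofReal (1 + 1 / L)) (ENNReal.ofReal n) (ENNReal.ofReal_pos.2 hc0).ne'
    ENNReal.ofReal_ne_top
    (by
      intro x u
      apply ENNReal.ofReal_le_ofReal
      have h1 := hfin (x 0)
      have h2 := hfin u
      have := qcor_nonneg n hL (u.1 : ℝ)
      refine max_le hn0.le ?_
      have : |((x 0).1 : ℝ) - u.1| ≤ n := by
        rw [abs_le]
        constructor <;> linarith
      linarith)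
    (by
      intro x x' u hl
      obtain ⟨r, hr, hcase⟩ := pathStep n hn2 u (fun z => pot n L (x' 0).1 z)
        (fun z => le_max_left _ _)
      have h1 := pot_step n (x := (x 0).1) hL hn (hadj _ _ (hl 0)) hcase
      have h2 : ENNReal.ofReal r ≤ stepE (SimpleGraph.pathGraph n)
          (fun (x : Fin 1 → Fin n) (u : Fin n) => ENNReal.ofReal (pot n L (x 0).1 u.1)) x' u := by
        rw [← hr]
        unfold stepE
        refine Finset.sum_le_sum fun v _ => ?_
        by_cases hc : (∃ i, x' i = v) ∨ ∃ i, x' i = u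
        · by_cases ha : (SimpleGraph.pathGraph n).Adj u v
          · have : pot n L (x' 0).1 v.1 = 0 := by
              apply pot0
              apply hadj
              rcases hc with ⟨i, hi⟩ | ⟨i, hi⟩
              · rw [Subsingleton.elim i 0] at hi
                exact Or.inl hi.symm
              · rw [Subsingleton.elim i 0] at hi
                rw [hi]
                exact Or.inr ha
            rw [this]
            simp
          · rw [stepP, if_neg ha]
            simp
        · rw [if_neg hc]
      calc ENNReal.ofReal (pot n L (x 0).1 u.1) ≤ ENNReal.ofReal (r + (1 + 1 / L)) :=
            ENNReal.ofReal_le_ofReal h1.2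
        _ = ENNReal.ofReal r + ENNReal.ofReal (1 + 1 / L) := ENNReal.ofReal_add h1.1 hc0.le
        _ ≤ _ := by gcongr)
  refine ENNReal.div_le_of_le_mul ?_
  rw [mul_comm]
  refine le_trans ?_ main
  have potnn : ∀ u : Fin n, 0 ≤ pot n L (sc.init 0).1 u.1 := fun _ => le_max_left _ _
  have hsum : (∑ u : Fin n, if ∃ i, sc.init i = u then 0 else
      ENNReal.ofReal (pot n L (sc.init 0).1 u.1))
      = ENNReal.ofReal (∑ u : Fin n, pot n L (sc.init 0).1 u.1) := by
    rw [ENNReal.ofReal_sum_of_nonneg (fun u _ => potnn u)]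
    refine Finset.sum_congr rfl fun u _ => ?_
    split_ifs with h
    · obtain ⟨i, hi⟩ := h
      rw [Subsingleton.elim i 0] at hi
      rw [pot0 _ _ (by rw [hi]; simp)]
      simp
    · rfl
  have hlow : (n * n - 1) / 4 - n * L - n ≤ ∑ u : Fin n, pot n L (sc.init 0).1 u.1 := by
    have h1 : ∑ u : Fin n, (|((sc.init 0).1 : ℝ) - u.1| - (L + 1))
        ≤ ∑ u : Fin n, pot n L (sc.init 0).1 u.1 := by
      refine Finset.sum_le_sum fun u _ => ?_
      have := qcor_le n hL (hfin u).1 (hfin u).2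
      exact le_trans (by linarith) (le_max_right _ _)
    rw [Finset.sum_sub_distrib, sum_abs_fin] at h1
    simp only [Finset.sum_const, Finset.card_univ, Fintype.card_fin, nsmul_eq_mul] at h1
    nlinarith [sq_nonneg ((n : ℝ) - 1 - 2 * (sc.init 0).1)]
  calc ENNReal.ofReal ((n - 1 / n) / 4 - L - 1)
      ≤ ENNReal.ofReal ((n : ℝ)⁻¹ * ∑ u : Fin n, pot n L (sc.init 0).1 u.1) := by
        apply ENNReal.ofReal_le_ofReal
        refine le_trans (le_of_eq ?_) (mul_le_mul_of_nonneg_left hlow (by positivity))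
        field_simp
    _ = (Fintype.card (Fin n) : ℝ≥0∞)⁻¹ *
        ENNReal.ofReal (∑ u : Fin n, pot n L (sc.init 0).1 u.1) := by
        rw [Fintype.card_fin, ENNReal.ofReal_mul (by positivity), ENNReal.ofReal_inv_of_pos hn0,
          ENNReal.ofReal_natCast]
    _ ≤ _ := by
        rw [← hsum]
        apply le_of_eq
        congr!

lemma dct_toReal_bounds (n : ℕ) (hn : 4 ≤ n) :
    ((n - 1 / n) / 4 - √n - 1) / (1 + 1 / √n) ≤ (dct (SimpleGraph.pathGraph n) 1).toReal ∧
      (dct (SimpleGraph.pathGraph n) 1).toReal ≤ n / 4 := by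
  have hup := dct_le n (by omega)
  have hn4 : (4 : ℝ) ≤ n := by exact_mod_cast hn
  have hsq : √(n : ℝ) * √n = n := Real.mul_self_sqrt (by linarith)
  have hs2 : 2 ≤ √(n : ℝ) := by
    rw [show (2 : ℝ) = √4 by rw [show (4 : ℝ) = 2 ^ 2 by norm_num]; simp]
    exact Real.sqrt_le_sqrt hn4
  have hlow := le_dct n (by omega) (L := √n) (by linarith) (by nlinarith)
  have hfin : dct (SimpleGraph.pathGraph n) 1 ≠ ⊤ := ne_top_of_le_ne_top ENNReal.ofReal_ne_top hup
  constructor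
  · rw [← ENNReal.ofReal_div_of_pos (by positivity)] at hlow
    exact (ENNReal.ofReal_le_iff_le_toReal hfin).1 hlow
  · exact ENNReal.toReal_le_of_le_ofReal (by positivity) hup

lemma tendsto_dct :
    Filter.Tendsto
      (fun n : ℕ => (dct (SimpleGraph.pathGraph n) 1).toReal / ((n : ℝ) / 4))
      Filter.atTop (nhds 1) := by
  have hs : Filter.Tendsto (fun n : ℕ => (√(n : ℝ))⁻¹) Filter.atTop (nhds 0) :=
    (Real.tendsto_sqrt_atTop.comp tendsto_natCast_atTop_atTop).inv_tendsto_atTop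
  have hlim : Filter.Tendsto (fun n : ℕ => (1 - (√(n : ℝ))⁻¹ ^ 4 - 4 * (√(n : ℝ))⁻¹
      - 4 * (√(n : ℝ))⁻¹ ^ 2) / (1 + (√(n : ℝ))⁻¹)) Filter.atTop (nhds 1) := by
    have h1 : ContinuousAt (fun s : ℝ => (1 - s ^ 4 - 4 * s - 4 * s ^ 2) / (1 + s)) 0 := by
      apply ContinuousAt.div
      · fun_prop
      · fun_prop
      · norm_num
    have h2 := h1.tendsto.comp hs
    norm_num at h2
    simpa [Function.comp_def] using h2
  refine tendsto_of_tendsto_of_tendsto_of_le_of_le' hlim tendsto_const_nhds ?_ ?_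
  · filter_upwards [Filter.eventually_ge_atTop 4] with n hn
    have hb := (dct_toReal_bounds n hn).1
    have hn4 : (4 : ℝ) ≤ n := by exact_mod_cast hn
    rw [le_div_iff₀ (by positivity)]
    refine le_trans (le_of_eq ?_) hb
    have hsq : (n : ℝ) = √(n : ℝ) ^ 2 := (Real.sq_sqrt (by linarith)).symm
    have hs0 : 0 < √(n : ℝ) := Real.sqrt_pos.2 (by linarith)
    generalize √(n : ℝ) = s at *
    rw [hsq]
    field_simp
  · filter_upwards [Filter.eventually_ge_atTop 4] with n hn
    have hb := (dct_toReal_bounds n hn).2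
    have hn4 : (4 : ℝ) ≤ n := by exact_mod_cast hn
    rw [div_le_one (by positivity)]
    exact hb

lemma tendsto_half :
    Filter.Tendsto (fun n : ℕ => ((n / 2 : ℕ) : ℝ) / ((n : ℝ) / 4)) Filter.atTop (nhds 2) := by
  have hinv : Filter.Tendsto (fun n : ℕ => 2 - 2 * ((n : ℝ))⁻¹) Filter.atTop (nhds 2) := by
    have := (tendsto_inv_atTop_nhds_zero_nat (𝕜 := ℝ)).const_mul 2
    simpa using this.const_sub 2
  refine tendsto_of_tendsto_of_tendsto_of_le_of_le' hinv tendsto_const_nhds ?_ ?_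
  · filter_upwards [Filter.eventually_ge_atTop 1] with n hn
    have hn1 : (0 : ℝ) < n := by exact_mod_cast hn
    rw [le_div_iff₀ (by positivity)]
    have h : n ≤ 2 * (n / 2) + 1 := by omega
    have h' : (n : ℝ) ≤ 2 * ((n / 2 : ℕ) : ℝ) + 1 := by exact_mod_cast h
    have e : (2 - 2 * (n : ℝ)⁻¹) * (n / 4) = (n - 1) / 2 := by
      field_simp
      ring
    rw [e]
    linarith
  · filter_upwards [Filter.eventually_ge_atTop 1] with n hn
    have hn1 : (0 : ℝ) < n := by exact_mod_cast hn
    rw [div_le_iff₀ (by positivity)]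
    have h : 2 * (n / 2) ≤ n := by omega
    have h' : 2 * ((n / 2 : ℕ) : ℝ) ≤ n := by exact_mod_cast h
    linarith

end CopsRobbers

open Filter

/-- for the path `P_n`, `dct(P_n) = (1+o(1)) n/4`, `ct(P_n) = ⌊n/2⌋`, and
hence the cost of drunkenness is `F(P_n) = ct(P_n)/dct(P_n) = 2 + o(1)` as `n → ∞`. -/
theorem cost_of_drunkenness_pathGraph :
    (∀ n : ℕ, 1 ≤ n →
        CopsRobbers.ct (SimpleGraph.pathGraph n) 1 = ((n / 2 : ℕ) : ℝ≥0∞)) ∧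
      Tendsto
        (fun n : ℕ =>
          (CopsRobbers.dct (SimpleGraph.pathGraph n) 1).toReal / ((n : ℝ) / 4))
        atTop (nhds 1) ∧
      Tendsto
        (fun n : ℕ =>
          (CopsRobbers.ct (SimpleGraph.pathGraph n) 1).toReal /
            (CopsRobbers.dct (SimpleGraph.pathGraph n) 1).toReal)
        atTop (nhds 2) := by
  refine ⟨CopsRobbers.ct_pathGraph, CopsRobbers.tendsto_dct, ?_⟩
  have h := CopsRobbers.tendsto_half.div CopsRobbers.tendsto_dct one_ne_zero
  rw [div_one] at h
  refine h.congr' ?_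
  filter_upwards [eventually_ge_atTop 1] with n hn
  have hn0 : (n : ℝ) / 4 ≠ 0 := by
    have : (0 : ℝ) < n := by exact_mod_cast hn
    positivity
  rw [CopsRobbers.ct_pathGraph n hn, ENNReal.toReal_natCast]
  exact div_div_div_cancel_right₀ hn0 _ _
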